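/- Let λ > 0, let x = (x₁,x₂,x₃) ∈ [−π,π)³, and let w₂ = (1,−2,1)ᵀ so that ⟨x,w₂⟩ = x₁ − 2x₂ + x₃ and ‖w₂‖² = 6. If |(⟨x,w₂⟩)_{2π}| = π, then the set of minimizers over y ∈ [−π,π)³ of (1/2)∑_{j=1}³ dist(x_j,y_j)² + λ·|(y₁ − 2y₂ + y₃)_{2π}| consists of exactly the two points (x + m₂·w₂)_{2π} and (x − m₂·w₂)_{2π} (applied componentwise), where m₂ := min{λ, π/6}. -/

import Mathlib

open Real Set

/-- `wrap a` is the unique representative of `a` modulo `2π` lying in `[-π, π)`. -/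
noncomputable def wrap (a : ℝ) : ℝ := a - 2 * π * ↑⌊(a + π) / (2 * π)⌋

theorem wrap_mem_Ico (a : ℝ) : wrap a ∈ Ico (-π) π := by
  have h2 : 0 < 2 * π := two_pi_pos
  have h3 := (le_div_iff₀ h2).1 (Int.floor_le ((a + π) / (2 * π)))
  have h4 := (div_lt_iff₀ h2).1 (Int.lt_floor_add_one ((a + π) / (2 * π)))
  constructor <;> unfold wrap <;> linarith

theorem exists_wrap_eq (a : ℝ) : ∃ n : ℤ, wrap a = a - 2 * π * n := ⟨_, rfl⟩

theorem eq_wrap_of_mem_Ico {a b : ℝ} (ha : a ∈ Ico (-π) π) (n : ℤ) (h : a = b - 2 * π * n) :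
    a = wrap b := by
  have h2 : 0 < 2 * π := two_pi_pos
  have hfloor : ⌊(b + π) / (2 * π)⌋ = n := by
    rw [Int.floor_eq_iff, le_div_iff₀ h2, div_lt_iff₀ h2]
    constructor <;> linarith [ha.1, ha.2]
  rw [wrap, hfloor, h]

/-- `wrap a` has minimal absolute value in the class of `a` modulo `2π`. -/
theorem abs_wrap_le (a : ℝ) (n : ℤ) : |wrap a| ≤ |a - 2 * π * n| := by
  obtain ⟨k, hk⟩ := exists_wrap_eq a
  have hmem := wrap_mem_Ico a
  have hpi := pi_pos
  have habs : |wrap a| ≤ π := abs_le.2 ⟨hmem.1, hmem.2.le⟩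
  rcases lt_trichotomy n k with h | h | h
  · have h1 : (n : ℝ) + 1 ≤ k := by exact_mod_cast h
    have h2 : π ≤ a - 2 * π * n := by nlinarith [hmem.1]
    exact habs.trans (h2.trans (le_abs_self _))
  · rw [hk, h]
  · have h1 : (k : ℝ) + 1 ≤ n := by exact_mod_cast h
    have h2 : π ≤ -(a - 2 * π * n) := by nlinarith [hmem.2]
    exact habs.trans (h2.trans (neg_le_abs _))

/-- Quadratic growth of `s ↦ s² / 12 + lam * (π - s)⁺` around its minimizer `6 * min lam (π / 6)`. -/
theorem add_sq_le_of_pi_sub_le {lam m s c : ℝ} (hlam : 0 < lam) (hm : m = min lam (π / 6))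
    (hc : 0 ≤ c) (hsc : π - s ≤ c) :
    3 * m ^ 2 + lam * (π - 6 * m) + (s - 6 * m) ^ 2 / 12 ≤ s ^ 2 / 12 + lam * c := by
  have hpi := pi_pos
  rcases le_total lam (π / 6) with h | h
  · rw [min_eq_left h] at hm
    subst hm
    nlinarith
  · rw [min_eq_right h] at hm
    have hprod : π * (π - s) ≤ 6 * lam * c := by
      rcases le_total s π with hs | hs
      · nlinarith
      · nlinarith [mul_nonneg hlam.le hc]
    subst hm
    nlinarith

/-- The objective, as a function of the wrapped displacement `v = x - y` with `c` the absolute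
second-order cyclic difference of `y`, grows quadratically around `v = ± m • w₂`. -/
theorem add_sq_le_objective {lam m v₁ v₂ v₃ c : ℝ} (hlam : 0 < lam) (hm : m = min lam (π / 6))
    (hc : 0 ≤ c) (hvc : π - |v₁ - 2 * v₂ + v₃| ≤ c) :
    3 * m ^ 2 + lam * (π - 6 * m) + (|v₁ - 2 * v₂ + v₃| - 6 * m) ^ 2 / 12 +
      (1 / 2) * ((v₁ - (v₁ - 2 * v₂ + v₃) / 6) ^ 2 + (v₂ + (v₁ - 2 * v₂ + v₃) / 3) ^ 2 +
        (v₃ - (v₁ - 2 * v₂ + v₃) / 6) ^ 2) ≤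
      (1 / 2) * (|v₁| ^ 2 + |v₂| ^ 2 + |v₃| ^ 2) + lam * c := by
  have h := add_sq_le_of_pi_sub_le hlam hm hc hvc
  have hsq := sq_abs (v₁ - 2 * v₂ + v₃)
  rw [sq_abs v₁, sq_abs v₂, sq_abs v₃]
  linarith

theorem abs_wrap_le_of_eq {a b : ℝ} (n : ℤ) (h : a = b + 2 * π * n) : |wrap a| ≤ |b| := by
  have := abs_wrap_le a n
  rwa [h, add_sub_cancel_right, ← h] at this

theorem pi_sub_abs_le_abs_wrap {x₁ x₂ x₃ : ℝ} (hx : |wrap (x₁ - 2 * x₂ + x₃)| = π)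
    (y₁ y₂ y₃ : ℝ) :
    π - |wrap (x₁ - y₁) - 2 * wrap (x₂ - y₂) + wrap (x₃ - y₃)| ≤
      |wrap (y₁ - 2 * y₂ + y₃)| := by
  obtain ⟨n₁, h₁⟩ := exists_wrap_eq (x₁ - y₁)
  obtain ⟨n₂, h₂⟩ := exists_wrap_eq (x₂ - y₂)
  obtain ⟨n₃, h₃⟩ := exists_wrap_eq (x₃ - y₃)
  obtain ⟨k, hk⟩ := exists_wrap_eq (y₁ - 2 * y₂ + y₃)
  have h := abs_wrap_le_of_eq (a := x₁ - 2 * x₂ + x₃)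
    (b := wrap (y₁ - 2 * y₂ + y₃) +
      (wrap (x₁ - y₁) - 2 * wrap (x₂ - y₂) + wrap (x₃ - y₃)))
    (k + (n₁ - 2 * n₂ + n₃)) (by rw [h₁, h₂, h₃, hk]; push_cast; ring)
  rw [hx] at h
  linarith [abs_add_le (wrap (y₁ - 2 * y₂ + y₃))
    (wrap (x₁ - y₁) - 2 * wrap (x₂ - y₂) + wrap (x₃ - y₃))]

/-- The shift of `x` by `e • w₂` with `|e| = m` attains at most the optimal value. -/
theorem objective_shift_le {lam m e x₁ x₂ x₃ : ℝ} (hlam : 0 < lam)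
    (he : |e| = m) (hbound : |wrap (x₁ - 2 * x₂ + x₃ + 6 * e)| ≤ π - 6 * m) :
    (1 / 2) * (|wrap (x₁ - wrap (x₁ + e))| ^ 2 + |wrap (x₂ - wrap (x₂ - 2 * e))| ^ 2 +
      |wrap (x₃ - wrap (x₃ + e))| ^ 2) +
      lam * |wrap (wrap (x₁ + e) - 2 * wrap (x₂ - 2 * e) + wrap (x₃ + e))| ≤
      3 * m ^ 2 + lam * (π - 6 * m) := by
  obtain ⟨n₁, h₁⟩ := exists_wrap_eq (x₁ + e)
  obtain ⟨n₂, h₂⟩ := exists_wrap_eq (x₂ - 2 * e)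
  obtain ⟨n₃, h₃⟩ := exists_wrap_eq (x₃ + e)
  obtain ⟨k, hk⟩ := exists_wrap_eq (x₁ - 2 * x₂ + x₃ + 6 * e)
  have b₁ := abs_wrap_le_of_eq (a := x₁ - wrap (x₁ + e)) (b := -e) n₁ (by rw [h₁]; ring)
  have b₂ := abs_wrap_le_of_eq (a := x₂ - wrap (x₂ - 2 * e)) (b := 2 * e) n₂ (by rw [h₂]; ring)
  have b₃ := abs_wrap_le_of_eq (a := x₃ - wrap (x₃ + e)) (b := -e) n₃ (by rw [h₃]; ring)
  have b := abs_wrap_le_of_eq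
    (a := wrap (x₁ + e) - 2 * wrap (x₂ - 2 * e) + wrap (x₃ + e))
    (b := wrap (x₁ - 2 * x₂ + x₃ + 6 * e)) (k - (n₁ - 2 * n₂ + n₃))
    (by rw [h₁, h₂, h₃, hk]; push_cast; ring)
  rw [abs_neg, he] at b₁ b₃
  rw [abs_mul, abs_two, he] at b₂
  have s₁ := pow_le_pow_left₀ (abs_nonneg _) b₁ 2
  have s₂ := pow_le_pow_left₀ (abs_nonneg _) b₂ 2
  have s₃ := pow_le_pow_left₀ (abs_nonneg _) b₃ 2
  have s := mul_le_mul_of_nonneg_left (b.trans hbound) hlam.le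
  linarith

theorem eq_wrap_of_wrap_sub_eq {x y e : ℝ} (hy : y ∈ Ico (-π) π) (h : wrap (x - y) = e) :
    y = wrap (x - e) := by
  obtain ⟨n, hn⟩ := exists_wrap_eq (x - y)
  exact eq_wrap_of_mem_Ico hy n (by linarith)

theorem wrap_add_ne_wrap_sub {m : ℝ} (x : ℝ) (h0 : 0 < m) (hm : m < π) :
    wrap (x + m) ≠ wrap (x - m) := by
  intro h
  obtain ⟨n, hn⟩ := exists_wrap_eq (x + m)
  obtain ⟨k, hk⟩ := exists_wrap_eq (x - m)
  have hmk : m = π * ((n - k : ℤ) : ℝ) := by push_cast; linarith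
  have hpi := pi_pos
  have hpos : (0 : ℝ) < (n - k : ℤ) := by
    by_contra! hle
    nlinarith
  have hone : (1 : ℝ) ≤ (n - k : ℤ) := by exact_mod_cast hpos
  nlinarith

/-- prox of the second-order cyclic difference on S¹, boundary
case |(⟨x,w₂⟩)_{2π}| = π: the set of minimizers over y ∈ [−π,π)³ of
(1/2)∑ dist(xⱼ,yⱼ)² + λ|(y₁−2y₂+y₃)_{2π}| consists of exactly the two points
(x ± m₂·w₂)_{2π}, w₂ = (1,−2,1), m₂ = min{λ, π/6}. -/
theorem stmt10 (lam : ℝ) (hlam : 0 < lam) (x₁ x₂ x₃ : ℝ)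
    (hx₁ : x₁ ∈ Ico (-π) π) (hx₂ : x₂ ∈ Ico (-π) π) (hx₃ : x₃ ∈ Ico (-π) π)
    (d m q₁ q₂ q₃ r₁ r₂ r₃ : ℝ)
    (hd : d = wrap (x₁ - 2 * x₂ + x₃))
    (hdeq : |d| = π)
    (hm : m = min lam (π / 6))
    (hq₁ : q₁ = wrap (x₁ + m)) (hq₂ : q₂ = wrap (x₂ - 2 * m))
    (hq₃ : q₃ = wrap (x₃ + m))
    (hr₁ : r₁ = wrap (x₁ - m)) (hr₂ : r₂ = wrap (x₂ + 2 * m))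
    (hr₃ : r₃ = wrap (x₃ - m))
    (F : ℝ → ℝ → ℝ → ℝ)
    (hF : ∀ y₁ y₂ y₃ : ℝ, F y₁ y₂ y₃ =
      (1 / 2) * (|wrap (x₁ - y₁)| ^ 2 + |wrap (x₂ - y₂)| ^ 2 +
        |wrap (x₃ - y₃)| ^ 2) + lam * |wrap (y₁ - 2 * y₂ + y₃)|) :
    (q₁, q₂, q₃) ≠ (r₁, r₂, r₃) ∧
    q₁ ∈ Ico (-π) π ∧ q₂ ∈ Ico (-π) π ∧ q₃ ∈ Ico (-π) π ∧
    r₁ ∈ Ico (-π) π ∧ r₂ ∈ Ico (-π) π ∧ r₃ ∈ Ico (-π) π ∧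
    (∀ y₁ ∈ Ico (-π) π, ∀ y₂ ∈ Ico (-π) π, ∀ y₃ ∈ Ico (-π) π,
      ((∀ z₁ ∈ Ico (-π) π, ∀ z₂ ∈ Ico (-π) π, ∀ z₃ ∈ Ico (-π) π,
          F y₁ y₂ y₃ ≤ F z₁ z₂ z₃) ↔
        ((y₁ = q₁ ∧ y₂ = q₂ ∧ y₃ = q₃) ∨ (y₁ = r₁ ∧ y₂ = r₂ ∧ y₃ = r₃)))) := by
  subst hq₁ hq₂ hq₃ hr₁ hr₂ hr₃
  have hpi := pi_pos
  have hm0 : 0 < m := hm ▸ lt_min hlam (by positivity)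
  have hm6 : m ≤ π / 6 := hm ▸ min_le_right _ _
  have hgap : 0 ≤ π - 6 * m := by linarith
  have hdpi : d = -π := by
    have hmem := wrap_mem_Ico (x₁ - 2 * x₂ + x₃)
    rw [← hd] at hmem
    rcases eq_or_eq_neg_of_abs_eq hdeq with h | h
    · exact absurd h hmem.2.ne
    · exact h
  obtain ⟨k, hk⟩ := exists_wrap_eq (x₁ - 2 * x₂ + x₃)
  rw [← hd, hdpi] at hk
  rw [hd] at hdeq
  have hlower := fun y₁ y₂ y₃ : ℝ =>
    add_sq_le_objective hlam hm (abs_nonneg _) (pi_sub_abs_le_abs_wrap hdeq y₁ y₂ y₃)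
  have hq : F (wrap (x₁ + m)) (wrap (x₂ - 2 * m)) (wrap (x₃ + m)) ≤
      3 * m ^ 2 + lam * (π - 6 * m) := by
    rw [hF]
    refine objective_shift_le hlam (abs_of_pos hm0) ?_
    have h := abs_wrap_le_of_eq (a := x₁ - 2 * x₂ + x₃ + 6 * m) (b := -(π - 6 * m)) k
      (by linarith)
    rwa [abs_neg, abs_of_nonneg hgap] at h
  have hr : F (wrap (x₁ - m)) (wrap (x₂ + 2 * m)) (wrap (x₃ - m)) ≤
      3 * m ^ 2 + lam * (π - 6 * m) := by
    have h := abs_wrap_le_of_eq (a := x₁ - 2 * x₂ + x₃ + 6 * -m) (b := π - 6 * m) (k - 1)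
      (by push_cast; linarith)
    rw [abs_of_nonneg hgap] at h
    have h' := objective_shift_le hlam (by rw [abs_neg, abs_of_pos hm0]) h
    rwa [← hF, mul_neg, sub_neg_eq_add, ← sub_eq_add_neg, ← sub_eq_add_neg] at h'
  have hmin : ∀ z₁ z₂ z₃ : ℝ, 3 * m ^ 2 + lam * (π - 6 * m) ≤ F z₁ z₂ z₃ := by
    intro z₁ z₂ z₃
    rw [hF]
    refine le_trans ?_ (hlower z₁ z₂ z₃)
    rw [add_assoc]
    exact le_add_of_nonneg_right (by positivity)
  refine ⟨fun h => wrap_add_ne_wrap_sub x₁ hm0 (by linarith) (congrArg Prod.fst h),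
    wrap_mem_Ico _, wrap_mem_Ico _, wrap_mem_Ico _, wrap_mem_Ico _, wrap_mem_Ico _,
    wrap_mem_Ico _, fun y₁ hy₁ y₂ hy₂ y₃ hy₃ => ⟨fun hopt => ?_, ?_⟩⟩
  · have hle := (hopt _ (wrap_mem_Ico (x₁ + m)) _ (wrap_mem_Ico (x₂ - 2 * m)) _
      (wrap_mem_Ico (x₃ + m))).trans hq
    rw [hF] at hle
    have hlow := (hlower y₁ y₂ y₃).trans hle
    set v₁ := wrap (x₁ - y₁) with hv₁
    set v₂ := wrap (x₂ - y₂) with hv₂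
    set v₃ := wrap (x₃ - y₃) with hv₃
    set t := v₁ - 2 * v₂ + v₃ with ht
    have p := sq_nonneg (|t| - 6 * m)
    have p₁ := sq_nonneg (v₁ - t / 6)
    have p₂ := sq_nonneg (v₂ + t / 3)
    have p₃ := sq_nonneg (v₃ - t / 6)
    have z := pow_eq_zero_iff two_ne_zero |>.1 (le_antisymm (by linarith) p)
    have z₁ := pow_eq_zero_iff two_ne_zero |>.1 (le_antisymm (by linarith) p₁)
    have z₂ := pow_eq_zero_iff two_ne_zero |>.1 (le_antisymm (by linarith) p₂)
    have z₃ := pow_eq_zero_iff two_ne_zero |>.1 (le_antisymm (by linarith) p₃)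
    clear_value v₁ v₂ v₃ t
    rcases eq_or_eq_neg_of_abs_eq (sub_eq_zero.1 z) with h | h
    · right
      refine ⟨eq_wrap_of_wrap_sub_eq hy₁ (by linarith), ?_,
        eq_wrap_of_wrap_sub_eq hy₃ (by linarith)⟩
      rw [← sub_neg_eq_add]
      exact eq_wrap_of_wrap_sub_eq hy₂ (by linarith)
    · left
      refine ⟨?_, eq_wrap_of_wrap_sub_eq hy₂ (by linarith), ?_⟩ <;> rw [← sub_neg_eq_add]
      · exact eq_wrap_of_wrap_sub_eq hy₁ (by linarith)
      · exact eq_wrap_of_wrap_sub_eq hy₃ (by linarith)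
  · rintro (⟨rfl, rfl, rfl⟩ | ⟨rfl, rfl, rfl⟩) z₁ _ z₂ _ z₃ _
    · exact hq.trans (hmin _ _ _)
    · exact hr.trans (hmin _ _ _)
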